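/- arXiv:1503.04960 — 2 statements merged into one kernel-verified Lean document; each statement's English description precedes it below -/
import Mathlib

section
/- Let f be a subpolynomial function belonging to some Hardy field, of type x^{0+}, with lim_{x→∞} |f(x)/log x| = ∞ and lim_{x→∞} x·|f'(x)| = ∞. Then there exist positive constants (depending on f and, where indicated, on j) such that for every integer j ≥ 1 and all sufficiently large x: (i) c₁/log x ≤ x·f'(x)/f(x) ≤ C₁; (ii) c₂/(log x)² ≤ |x·f^{(j+1)}(x)/f^{(j)}(x) + j| ≤ C₂; (iii) c₃/(log x)² ≤ |x·f^{(j+1)}(x)/f^{(j)}(x)| ≤ C₃; (iv) 0 < f'(x)/f'(2x) ≤ C₄·log x. -/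
open Filter Topology MeasureTheory
open scoped Pointwise

noncomputable section

/-- The germ of a real function at `+∞`. -/
def germAtTop (f : ℝ → ℝ) : Filter.Germ (Filter.atTop : Filter ℝ) ℝ := ↑f

/-- A Hardy field: a subring of the ring of germs at `+∞` of real-valued functions
which is a field and is closed under differentiation. -/
def IsHardyField (H : Subring (Filter.Germ (Filter.atTop : Filter ℝ) ℝ)) : Prop :=
  (∀ g ∈ H, g ≠ 0 → ∃ h ∈ H, g * h = 1) ∧
  (∀ g ∈ H, ∃ f : ℝ → ℝ, germAtTop f = g ∧
    (∀ᶠ x in Filter.atTop, DifferentiableAt ℝ f x) ∧ germAtTop (deriv f) ∈ H)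

/-- A function is subpolynomial if it is eventually dominated by some power `x ^ n`. -/
def Subpolynomial (f : ℝ → ℝ) : Prop := ∃ n : ℕ, ∀ᶠ x in Filter.atTop, |f x| < x ^ n

open scoped Classical in
/-- A sequence of reals is uniformly distributed mod 1. -/
def UDMod1 (a : ℕ → ℝ) : Prop :=
  ∀ α β : ℝ, 0 ≤ α → α ≤ β → β ≤ 1 →
    Filter.Tendsto
      (fun N : ℕ =>
        (((Finset.range N).filter fun n => Int.fract (a n) ∈ Set.Icc α β).card : ℝ) / N)
      Filter.atTop (nhds (β - α))

open scoped Classical in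
/-- A sequence of points of the `d`-torus is uniformly distributed mod 1. -/
def UDMod1Vec {d : ℕ} (a : ℕ → Fin d → ℝ) : Prop :=
  ∀ α β : Fin d → ℝ, (∀ i, 0 ≤ α i) → (∀ i, α i ≤ β i) → (∀ i, β i ≤ 1) →
    Filter.Tendsto
      (fun N : ℕ =>
        (((Finset.range N).filter fun n =>
            ∀ i, Int.fract (a n i) ∈ Set.Icc (α i) (β i)).card : ℝ) / N)
      Filter.atTop (nhds (∏ i, (β i - α i)))

/-- The `n`-th prime (indexed from `0`, so `nthPrime 0 = 2`). -/
def nthPrime (n : ℕ) : ℕ := Nat.nth Nat.Prime n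

/-- `e x = exp (2 π i x)`. -/
def e (x : ℝ) : ℂ := Complex.exp (2 * Real.pi * Complex.I * x)

/-- `f` is of type `x^{l+}`: `x^l / f x → 0` and `f x / x^(l+1) → 0` as `x → ∞`. -/
def TypeXPow (f : ℝ → ℝ) (l : ℕ) : Prop :=
  Filter.Tendsto (fun x : ℝ => x ^ l / f x) Filter.atTop (nhds 0) ∧
  Filter.Tendsto (fun x : ℝ => f x / x ^ (l + 1)) Filter.atTop (nhds 0)

/-- Membership in the class `𝐇` attached to a Hardy field `H`: a subpolynomial member of `H`
which either is of type `x^{l+}` for some `l ≥ 1`, or satisfies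
`ξ x / x → 0` and `log x / ξ x → 0`. -/
def MemBoldH (H : Subring (Filter.Germ (Filter.atTop : Filter ℝ) ℝ)) (ξ : ℝ → ℝ) : Prop :=
  germAtTop ξ ∈ H ∧ Subpolynomial ξ ∧
  ((∃ l : ℕ, 1 ≤ l ∧
      Filter.Tendsto (fun x : ℝ => ξ x / x ^ (l + 1)) Filter.atTop (nhds 0) ∧
      Filter.Tendsto (fun x : ℝ => x ^ l / ξ x) Filter.atTop (nhds 0)) ∨
    (Filter.Tendsto (fun x : ℝ => ξ x / x) Filter.atTop (nhds 0) ∧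
      Filter.Tendsto (fun x : ℝ => Real.log x / ξ x) Filter.atTop (nhds 0)))

/-- The upper Banach density of a subset of `ℤ^m`. -/
def upperBanachDensity {m : ℕ} (E : Set (Fin m → ℤ)) : ℝ :=
  sSup { d : ℝ | ∃ a b : ℕ → Fin m → ℤ,
    (∀ i, Filter.Tendsto (fun n => b n i - a n i) Filter.atTop Filter.atTop) ∧
    d = Filter.limsup (fun n : ℕ =>
        (Nat.card ↥(E ∩ Set.pi Set.univ fun i => Set.Icc (a n i) (b n i)) : ℝ) /
        (Nat.card ↥(Set.pi Set.univ fun i : Fin m => Set.Icc (a n i) (b n i)) : ℝ))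
      Filter.atTop }

/-- The Fourier transform of a measure on the `m`-torus, evaluated at `d ∈ ℤ^m`. -/
def measureFourier {m : ℕ} (σ : Measure (Fin m → AddCircle (1 : ℝ))) (d : Fin m → ℤ) : ℂ :=
  ∫ γ, (∏ i, fourier (d i) (γ i)) ∂σ

/-- The filter `|d| → ∞, d ∈ D` on `ℤ^m`, where `|d| = max |d_i|`. -/
def alongD {m : ℕ} (D : Set (Fin m → ℤ)) : Filter (Fin m → ℤ) :=
  (Filter.atTop.comap fun d : Fin m → ℤ => Finset.univ.sup fun i => (d i).natAbs) ⊓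
    Filter.principal D

/-- A nice `FC⁺` set in `ℤ^m`. -/
def IsNiceFCPlus {m : ℕ} (D : Set (Fin m → ℤ)) : Prop :=
  D.Infinite ∧
  ∀ σ : Measure (Fin m → AddCircle (1 : ℝ)), IsFiniteMeasure σ →
    (σ {0}).toReal ≤ Filter.limsup (fun d => ‖measureFourier σ d‖) (alongD D)


namespace HardyAux

lemma ev_nhds {g f : ℝ → ℝ} (h : g =ᶠ[atTop] f) : ∀ᶠ x in atTop, g =ᶠ[𝓝 x] f := by
  obtain ⟨a, ha⟩ := eventually_atTop.1 h
  filter_upwards [eventually_gt_atTop a] with x hx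
  filter_upwards [Ioi_mem_nhds hx] with y hy
  exact ha y (le_of_lt hy)

lemma ev_deriv {g f : ℝ → ℝ} (h : g =ᶠ[atTop] f) : deriv g =ᶠ[atTop] deriv f := by
  filter_upwards [ev_nhds h] with x hx using hx.deriv_eq

lemma ev_diff {g f : ℝ → ℝ} (h : g =ᶠ[atTop] f)
    (hf : ∀ᶠ x in atTop, DifferentiableAt ℝ f x) : ∀ᶠ x in atTop, DifferentiableAt ℝ g x := by
  filter_upwards [ev_nhds h, hf] with x hx h2 using hx.differentiableAt_iff.2 h2

lemma ex_mono {g : ℝ → ℝ} (hd : ∀ᶠ x in atTop, DifferentiableAt ℝ g x)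
    (h : ∀ᶠ x in atTop, 0 ≤ deriv g x) : ∃ a, MonotoneOn g (Set.Ici a) := by
  obtain ⟨a, ha⟩ := eventually_atTop.1 (hd.and h)
  refine ⟨a, monotoneOn_of_deriv_nonneg (convex_Ici a)
    (fun x hx => (ha x hx).1.continuousAt.continuousWithinAt) ?_ ?_⟩
  · intro x hx
    exact (ha x (interior_subset hx)).1.differentiableWithinAt
  · intro x hx
    exact (ha x (interior_subset hx)).2

lemma ex_strict {g : ℝ → ℝ} (hd : ∀ᶠ x in atTop, DifferentiableAt ℝ g x)
    (h : ∀ᶠ x in atTop, 0 < deriv g x) : ∃ a, StrictMonoOn g (Set.Ici a) := by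
  obtain ⟨a, ha⟩ := eventually_atTop.1 (hd.and h)
  refine ⟨a, strictMonoOn_of_deriv_pos (convex_Ici a)
    (fun x hx => (ha x hx).1.continuousAt.continuousWithinAt) ?_⟩
  intro x hx
  exact (ha x (interior_subset hx)).2

/-- eventually zero, positive or negative -/
def Tri (g : ℝ → ℝ) : Prop :=
  (∀ᶠ x in atTop, g x = 0) ∨ (∀ᶠ x in atTop, 0 < g x) ∨ (∀ᶠ x in atTop, g x < 0)

lemma Tri.neg {g : ℝ → ℝ} (h : Tri g) : Tri (-g) := by
  rcases h with h | h | h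
  · exact Or.inl (h.mono fun x hx => by simp [hx])
  · exact Or.inr (Or.inr (h.mono fun x hx => by simpa using hx))
  · exact Or.inr (Or.inl (h.mono fun x hx => by simpa using hx))

lemma Tri.congr {g f : ℝ → ℝ} (h : Tri f) (e : g =ᶠ[atTop] f) : Tri g := by
  rcases h with h | h | h
  · exact Or.inl (by filter_upwards [h, e] with x hx he; rw [he]; exact hx)
  · exact Or.inr (Or.inl (by filter_upwards [h, e] with x hx he; rw [he]; exact hx))
  · exact Or.inr (Or.inr (by filter_upwards [h, e] with x hx he; rw [he]; exact hx))

lemma Tri.mul {g f : ℝ → ℝ} (h : Tri f) (h' : Tri g) : Tri (f * g) := by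
  rcases h with h | h | h
  · exact Or.inl (h.mono fun x hx => by simp [hx])
  · rcases h' with h' | h' | h'
    · exact Or.inl (h'.mono fun x hx => by simp [hx])
    · exact Or.inr (Or.inl (by filter_upwards [h, h'] with x h1 h2 using mul_pos h1 h2))
    · exact Or.inr (Or.inr (by filter_upwards [h, h'] with x h1 h2 using mul_neg_of_pos_of_neg h1 h2))
  · rcases h' with h' | h' | h'
    · exact Or.inl (h'.mono fun x hx => by simp [hx])
    · exact Or.inr (Or.inr (by filter_upwards [h, h'] with x h1 h2 using mul_neg_of_neg_of_pos h1 h2))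
    · exact Or.inr (Or.inl (by filter_upwards [h, h'] with x h1 h2 using mul_pos_of_neg_of_neg h1 h2))

lemma Tri.inv {g : ℝ → ℝ} (h : Tri g) : Tri (g⁻¹) := by
  rcases h with h | h | h
  · exact Or.inl (h.mono fun x hx => by simp [hx])
  · exact Or.inr (Or.inl (h.mono fun x hx => by simpa using hx))
  · exact Or.inr (Or.inr (h.mono fun x hx => by simpa using hx))

lemma tri_of_pos {g : ℝ → ℝ} (hd : ∀ᶠ x in atTop, DifferentiableAt ℝ g x)
    (h : ∀ᶠ x in atTop, 0 < deriv g x) : Tri g := by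
  obtain ⟨a, ha⟩ := ex_strict hd h
  by_cases hb : ∃ b, a ≤ b ∧ 0 ≤ g b
  · obtain ⟨b, hab, hb⟩ := hb
    refine Or.inr (Or.inl ?_)
    filter_upwards [eventually_gt_atTop b] with x hx
    exact hb.trans_lt (ha hab (hab.trans hx.le) hx)
  · push Not at hb
    exact Or.inr (Or.inr (eventually_atTop.2 ⟨a, hb⟩))

lemma tri_of_deriv {g : ℝ → ℝ} (hd : ∀ᶠ x in atTop, DifferentiableAt ℝ g x)
    (h : Tri (deriv g)) : Tri g := by
  have hd' : ∀ᶠ x in atTop, DifferentiableAt ℝ (-g) x := hd.mono fun x hx => hx.neg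
  have hdn : deriv (-g) = -deriv g := by ext x; simp
  rcases h with h | h | h
  · obtain ⟨a, ha⟩ := ex_mono hd (h.mono fun x hx => hx.ge)
    obtain ⟨b, hb⟩ := ex_mono hd' (h.mono fun x hx => by rw [hdn]; simp [hx])
    have hc : ∀ x, max a b ≤ x → g x = g (max a b) := by
      intro x hx
      have h1 := ha (le_max_left a b) ((le_max_left a b).trans hx) hx
      have h2 := hb (le_max_right a b) ((le_max_right a b).trans hx) hx
      simp only [Pi.neg_apply] at h2
      linarith
    have hc : g =ᶠ[atTop] fun _ => g (max a b) := eventually_atTop.2 ⟨_, hc⟩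
    refine Tri.congr ?_ hc
    rcases lt_trichotomy (g (max a b)) 0 with h | h | h
    · exact Or.inr (Or.inr (Eventually.of_forall fun _ => h))
    · exact Or.inl (Eventually.of_forall fun _ => h)
    · exact Or.inr (Or.inl (Eventually.of_forall fun _ => h))
  · exact tri_of_pos hd h
  · have := (tri_of_pos hd' (h.mono fun x hx => by rw [hdn]; simpa using hx)).neg
    simpa using this

/-- Hardy fields, as sets of functions. -/
structure HS (K : Set (ℝ → ℝ)) : Prop where
  congr : ∀ f ∈ K, ∀ g, g =ᶠ[atTop] f → g ∈ K
  one : (1 : ℝ → ℝ) ∈ K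
  add : ∀ f ∈ K, ∀ g ∈ K, f + g ∈ K
  neg : ∀ f ∈ K, -f ∈ K
  mul : ∀ f ∈ K, ∀ g ∈ K, f * g ∈ K
  inv : ∀ f ∈ K, f⁻¹ ∈ K
  diff : ∀ f ∈ K, ∀ᶠ x in atTop, DifferentiableAt ℝ f x
  deriv : ∀ f ∈ K, _root_.deriv f ∈ K
  tri : ∀ f ∈ K, Tri f

namespace HS
variable {K : Set (ℝ → ℝ)} (hK : HS K)
include hK

lemma sub {f g} (hf : f ∈ K) (hg : g ∈ K) : f - g ∈ K := by
  rw [sub_eq_add_neg]; exact hK.add _ hf _ (hK.neg _ hg)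

lemma div {f g} (hf : f ∈ K) (hg : g ∈ K) : f / g ∈ K := by
  rw [div_eq_mul_inv]; exact hK.mul _ hf _ (hK.inv _ hg)

lemma zero : (0 : ℝ → ℝ) ∈ K := by
  have := hK.sub hK.one hK.one
  simpa using this

lemma nat (n : ℕ) : (fun _ => (n : ℝ)) ∈ K := by
  induction n with
  | zero => exact hK.congr _ hK.zero _ (Eventually.of_forall fun x => by simp)
  | succ n ih =>
    have := hK.add _ ih _ hK.one
    refine hK.congr _ this _ (Eventually.of_forall fun x => ?_)
    simp

lemma pow {f} (hf : f ∈ K) (n : ℕ) : f ^ n ∈ K := by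
  induction n with
  | zero => simpa using hK.one
  | succ n ih => rw [pow_succ]; exact hK.mul _ ih _ hf

lemma le_or_lt {f g} (hf : f ∈ K) (hg : g ∈ K) :
    (∀ᶠ x in atTop, f x ≤ g x) ∨ (∀ᶠ x in atTop, g x < f x) := by
  rcases hK.tri _ (hK.sub hf hg) with h | h | h
  · exact Or.inl (h.mono fun x hx => by simp at hx; linarith)
  · exact Or.inr (h.mono fun x hx => by simp at hx; linarith)
  · exact Or.inl (h.mono fun x hx => by simp at hx; linarith)

end HS

/-- polynomials in `F` of degree at most `n` over `K` -/
def PolyS (K : Set (ℝ → ℝ)) (F : ℝ → ℝ) : ℕ → Set (ℝ → ℝ)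
  | 0 => K
  | n + 1 => {g | ∃ a ∈ K, ∃ p ∈ PolyS K F n, g =ᶠ[atTop] a + F * p}

section
variable {K : Set (ℝ → ℝ)} (hK : HS K) {F : ℝ → ℝ}
include hK

lemma poly_congr {n} {g f : ℝ → ℝ} (hf : f ∈ PolyS K F n) (e : g =ᶠ[atTop] f) :
    g ∈ PolyS K F n := by
  cases n with
  | zero => exact hK.congr _ hf _ e
  | succ n =>
    obtain ⟨a, ha, p, hp, h⟩ := hf
    exact ⟨a, ha, p, hp, e.trans h⟩

lemma poly_zero (n) : (0 : ℝ → ℝ) ∈ PolyS K F n := by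
  induction n with
  | zero => exact hK.zero
  | succ n ih => exact ⟨0, hK.zero, 0, ih, by simp⟩

lemma poly_of {n} {f : ℝ → ℝ} (hf : f ∈ K) : f ∈ PolyS K F n := by
  cases n with
  | zero => exact hf
  | succ n => exact ⟨f, hf, 0, poly_zero hK n, by simp⟩

lemma poly_succ {n} {f : ℝ → ℝ} (hf : f ∈ PolyS K F n) : f ∈ PolyS K F (n+1) := by
  induction n generalizing f with
  | zero => exact poly_of hK hf
  | succ n ih =>
    obtain ⟨a, ha, p, hp, h⟩ := hf
    exact ⟨a, ha, p, ih hp, h⟩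

lemma poly_le {m n} (h : m ≤ n) {f : ℝ → ℝ} (hf : f ∈ PolyS K F m) : f ∈ PolyS K F n := by
  induction h with
  | refl => exact hf
  | step _ ih => exact poly_succ hK ih

lemma poly_F {n} {f : ℝ → ℝ} (hf : f ∈ PolyS K F n) : F * f ∈ PolyS K F (n+1) :=
  ⟨0, hK.zero, f, hf, by simp⟩

lemma poly_add {n} {f g : ℝ → ℝ} (hf : f ∈ PolyS K F n) (hg : g ∈ PolyS K F n) :
    f + g ∈ PolyS K F n := by
  induction n generalizing f g with
  | zero => exact hK.add _ hf _ hg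
  | succ n ih =>
    obtain ⟨a, ha, p, hp, h⟩ := hf
    obtain ⟨b, hb, q, hq, h'⟩ := hg
    refine ⟨a + b, hK.add _ ha _ hb, p + q, ih hp hq, ?_⟩
    filter_upwards [h, h'] with x h1 h2
    simp only [Pi.add_apply, Pi.mul_apply] at *
    rw [h1, h2]; ring

lemma poly_smul {n} {f g : ℝ → ℝ} (hf : f ∈ K) (hg : g ∈ PolyS K F n) :
    f * g ∈ PolyS K F n := by
  induction n generalizing g with
  | zero => exact hK.mul _ hf _ hg
  | succ n ih =>
    obtain ⟨b, hb, q, hq, h'⟩ := hg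
    refine ⟨f * b, hK.mul _ hf _ hb, f * q, ih hq, ?_⟩
    filter_upwards [h'] with x h2
    simp only [Pi.add_apply, Pi.mul_apply] at *
    rw [h2]; ring

lemma poly_neg {n} {g : ℝ → ℝ} (hg : g ∈ PolyS K F n) : -g ∈ PolyS K F n := by
  have := poly_smul hK (hK.neg _ hK.one) hg
  simpa using this

lemma poly_mul {m n} {f g : ℝ → ℝ} (hf : f ∈ PolyS K F m) (hg : g ∈ PolyS K F n) :
    f * g ∈ PolyS K F (m + n) := by
  induction m generalizing f with
  | zero => rw [Nat.zero_add]; exact poly_smul hK hf hg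
  | succ m ih =>
    obtain ⟨a, ha, p, hp, h⟩ := hf
    have h1 := poly_le hK (show n ≤ m + 1 + n by omega) (poly_smul hK ha hg)
    have h2 := poly_le hK (show m + n + 1 ≤ m + 1 + n by omega) (poly_F hK (ih hp))
    refine poly_congr hK (poly_add hK h1 h2) ?_
    filter_upwards [h] with x h2
    simp only [Pi.add_apply, Pi.mul_apply] at *
    rw [h2]; ring

lemma poly_pow (n : ℕ) : F ^ n ∈ PolyS K F n := by
  induction n with
  | zero => simpa using poly_of hK hK.one
  | succ n ih => rw [pow_succ']; exact poly_F hK ih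

lemma poly_lead {n} {f : ℝ → ℝ} (hf : f ∈ PolyS K F (n+1)) :
    ∃ a ∈ K, ∃ p ∈ PolyS K F n, f =ᶠ[atTop] a * F ^ (n+1) + p := by
  induction n generalizing f with
  | zero =>
    obtain ⟨a, ha, p, hp, h⟩ := hf
    refine ⟨p, hp, a, ha, ?_⟩
    filter_upwards [h] with x h2
    simp only [Pi.add_apply, Pi.mul_apply, Pi.pow_apply] at *
    rw [h2]; ring
  | succ n ih =>
    obtain ⟨a, ha, p, hp, h⟩ := hf
    obtain ⟨b, hb, q, hq, h'⟩ := ih hp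
    refine ⟨b, hb, a + F * q, ⟨a, ha, q, hq, EventuallyEq.rfl⟩, ?_⟩
    filter_upwards [h, h'] with x h1 h2
    simp only [Pi.add_apply, Pi.mul_apply, Pi.pow_apply] at *
    rw [h1, h2]; ring

variable (hF : ∀ᶠ x in atTop, DifferentiableAt ℝ F x) (hF' : deriv F ∈ K)
include hF

lemma poly_diff {n} {f : ℝ → ℝ} (hf : f ∈ PolyS K F n) :
    ∀ᶠ x in atTop, DifferentiableAt ℝ f x := by
  induction n generalizing f with
  | zero => exact hK.diff _ hf
  | succ n ih =>
    obtain ⟨a, ha, p, hp, h⟩ := hf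
    refine ev_diff h ?_
    filter_upwards [hK.diff _ ha, ih hp, hF] with x h1 h2 h3
    exact h1.add (h3.mul h2)

include hF'

lemma poly_deriv {n} {f : ℝ → ℝ} (hf : f ∈ PolyS K F n) : deriv f ∈ PolyS K F n := by
  induction n generalizing f with
  | zero => exact hK.deriv _ hf
  | succ n ih =>
    obtain ⟨a, ha, p, hp, h⟩ := hf
    have h1 : deriv a ∈ PolyS K F (n+1) := poly_of hK (hK.deriv _ ha)
    have h2 : deriv F * p ∈ PolyS K F (n+1) := poly_succ hK (poly_smul hK hF' hp)
    have h3 := poly_F hK (ih hp)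
    refine poly_congr hK (poly_add hK h1 (poly_add hK h2 h3)) ((ev_deriv h).trans ?_)
    filter_upwards [hK.diff _ ha, poly_diff hK hF hp, hF] with x h1 h2 h3
    rw [deriv_add h1 (h3.mul h2), deriv_mul h3 h2]
    rfl

lemma poly_tri {n} {f : ℝ → ℝ} (hf : f ∈ PolyS K F n) : Tri f := by
  induction n generalizing f with
  | zero => exact hK.tri _ hf
  | succ n ih =>
    obtain ⟨a, ha, p, hp, h⟩ := poly_lead hK hf
    by_cases h0 : ∀ᶠ x in atTop, a x = 0
    · refine Tri.congr (ih hp) ?_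
      filter_upwards [h, h0] with x h1 h2
      simp [h1, h2]
    have hne : ∀ᶠ x in atTop, a x ≠ 0 := by
      rcases hK.tri _ ha with h | h | h
      · exact absurd h h0
      · exact h.mono fun x hx => hx.ne'
      · exact h.mono fun x hx => hx.ne
    have hq : a⁻¹ * p ∈ PolyS K F n := poly_smul hK (hK.inv _ ha) hp
    have e : f =ᶠ[atTop] a * (F ^ (n+1) + a⁻¹ * p) := by
      filter_upwards [h, hne] with x h1 h2
      simp only [Pi.add_apply, Pi.mul_apply, Pi.pow_apply, Pi.inv_apply] at *
      rw [h1]; field_simp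
    refine Tri.congr (Tri.mul (hK.tri _ ha) ?_) e
    have hqd := poly_diff hK hF hq
    apply tri_of_deriv
    · filter_upwards [hF, hqd] with x h1 h2 using (h1.pow _).add h2
    · have : ((fun _ => ((n+1 : ℕ) : ℝ)) * deriv F) * F ^ n + deriv (a⁻¹ * p) ∈ PolyS K F n :=
        poly_add hK (poly_smul hK (hK.mul _ (hK.nat _) _ hF') (poly_pow hK n))
          (poly_deriv hK hF hF' hq)
      refine Tri.congr (ih this) ?_
      filter_upwards [hF, hqd] with x h1 h2
      rw [deriv_add (h1.pow _) h2, deriv_pow h1]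
      simp only [Pi.add_apply, Pi.mul_apply, Pi.pow_apply, Nat.add_sub_cancel]
      ring

end

/-- The field generated by `F` over `K`. -/
def FracS (K : Set (ℝ → ℝ)) (F : ℝ → ℝ) : Set (ℝ → ℝ) :=
  {g | ∃ n, ∃ p ∈ PolyS K F n, ∃ m, ∃ q ∈ PolyS K F m, (∀ᶠ x in atTop, q x ≠ 0) ∧
    g =ᶠ[atTop] p / q}

lemma frac_of {K : Set (ℝ → ℝ)} (hK : HS K) {F : ℝ → ℝ} {n} {f : ℝ → ℝ}
    (hf : f ∈ PolyS K F n) : f ∈ FracS K F :=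
  ⟨n, f, hf, 0, 1, hK.one, by simp, by simp⟩

lemma frac_F {K : Set (ℝ → ℝ)} (hK : HS K) {F : ℝ → ℝ} : F ∈ FracS K F := by
  have := poly_pow hK (F := F) 1
  rw [pow_one] at this
  exact frac_of hK this

lemma frac_hs {K : Set (ℝ → ℝ)} (hK : HS K) {F : ℝ → ℝ}
    (hF : ∀ᶠ x in atTop, DifferentiableAt ℝ F x) (hF' : deriv F ∈ K) : HS (FracS K F) where
  congr := by
    rintro f ⟨n, p, hp, m, q, hq, h0, e⟩ g hg
    exact ⟨n, p, hp, m, q, hq, h0, hg.trans e⟩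
  one := frac_of hK (n := 0) hK.one
  add := by
    rintro f ⟨n, p, hp, m, q, hq, h0, e⟩ f' ⟨n', p', hp', m', q', hq', h0', e'⟩
    refine ⟨(n + m') + (n' + m), p * q' + p' * q,
      poly_add hK (poly_le hK (by omega) (poly_mul hK hp hq'))
        (poly_le hK (by omega) (poly_mul hK hp' hq)), m + m', q * q', poly_mul hK hq hq', ?_, ?_⟩
    · filter_upwards [h0, h0'] with x h1 h2 using mul_ne_zero h1 h2
    · filter_upwards [h0, h0', e, e'] with x h1 h2 h3 h4
      simp only [Pi.add_apply, Pi.mul_apply, Pi.div_apply] at *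
      rw [h3, h4]; field_simp
  neg := by
    rintro f ⟨n, p, hp, m, q, hq, h0, e⟩
    refine ⟨n, -p, poly_neg hK hp, m, q, hq, h0, ?_⟩
    filter_upwards [e] with x h3
    simp only [Pi.neg_apply, Pi.div_apply] at *
    rw [h3]; ring
  mul := by
    rintro f ⟨n, p, hp, m, q, hq, h0, e⟩ f' ⟨n', p', hp', m', q', hq', h0', e'⟩
    refine ⟨_, p * p', poly_mul hK hp hp', m + m', q * q', poly_mul hK hq hq', ?_, ?_⟩
    · filter_upwards [h0, h0'] with x h1 h2 using mul_ne_zero h1 h2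
    · filter_upwards [h0, h0', e, e'] with x h1 h2 h3 h4
      simp only [Pi.mul_apply, Pi.div_apply] at *
      rw [h3, h4]; field_simp
  inv := by
    rintro f ⟨n, p, hp, m, q, hq, h0, e⟩
    have : (∀ᶠ x in atTop, p x = 0) ∨ (∀ᶠ x in atTop, p x ≠ 0) := by
      rcases poly_tri hK hF hF' hp with h | h | h
      · exact Or.inl h
      · exact Or.inr (h.mono fun x hx => hx.ne')
      · exact Or.inr (h.mono fun x hx => hx.ne)
    rcases this with h | h
    · refine ⟨0, 0, hK.zero, 0, 1, hK.one, by simp, ?_⟩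
      filter_upwards [e, h] with x h1 h2
      simp [h1, h2]
    · refine ⟨m, q, hq, n, p, hp, h, ?_⟩
      filter_upwards [e] with x h1
      simp [h1]
  diff := by
    rintro f ⟨n, p, hp, m, q, hq, h0, e⟩
    refine ev_diff e ?_
    filter_upwards [poly_diff hK hF hp, poly_diff hK hF hq, h0] with x h1 h2 h3
    exact h1.div h2 h3
  deriv := by
    rintro f ⟨n, p, hp, m, q, hq, h0, e⟩
    refine ⟨n + m, deriv p * q - p * deriv q, ?_, m + m, q * q, poly_mul hK hq hq, ?_, ?_⟩
    · rw [sub_eq_add_neg]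
      exact poly_add hK (poly_mul hK (poly_deriv hK hF hF' hp) hq)
        (poly_neg hK (poly_mul hK hp (poly_deriv hK hF hF' hq)))
    · filter_upwards [h0] with x h1 using mul_ne_zero h1 h1
    · filter_upwards [ev_deriv e, poly_diff hK hF hp, poly_diff hK hF hq, h0] with x h h1 h2 h3
      rw [h, deriv_div h1 h2 h3]
      simp [sq]
  tri := by
    rintro f ⟨n, p, hp, m, q, hq, h0, e⟩
    refine Tri.congr ?_ e
    rw [div_eq_mul_inv]
    exact Tri.mul (poly_tri hK hF hF' hp) (poly_tri hK hF hF' hq).inv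

lemma base_hs (H : Subring (Filter.Germ (Filter.atTop : Filter ℝ) ℝ)) (hH : IsHardyField H) :
    HS {g | germAtTop g ∈ H} := by
  have hcongr : ∀ {f g : ℝ → ℝ}, g =ᶠ[atTop] f → germAtTop g = germAtTop f :=
    fun h => Filter.Germ.coe_eq.2 h
  have hdiff : ∀ f : ℝ → ℝ, germAtTop f ∈ H →
      (∀ᶠ x in atTop, DifferentiableAt ℝ f x) ∧ germAtTop (deriv f) ∈ H := by
    intro f hf
    obtain ⟨g, hg, hd, hd'⟩ := hH.2 _ hf
    have e : f =ᶠ[atTop] g := (Filter.Germ.coe_eq.1 hg).symm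
    refine ⟨ev_diff e hd, ?_⟩
    rw [hcongr (ev_deriv e)]; exact hd'
  have hinv : ∀ f : ℝ → ℝ, germAtTop f ∈ H → (∀ᶠ x in atTop, f x = 0) ∨
      ((∀ᶠ x in atTop, f x ≠ 0) ∧ germAtTop f⁻¹ ∈ H) := by
    intro f hf
    by_cases h0 : germAtTop f = 0
    · have h1 : ((f : ℝ → ℝ) : Filter.Germ (atTop : Filter ℝ) ℝ) =
        ((fun _ : ℝ => (0:ℝ) : ℝ → ℝ) : Filter.Germ (atTop : Filter ℝ) ℝ) := h0
      exact Or.inl (Filter.Germ.coe_eq.1 h1)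
    · obtain ⟨h, hh, e⟩ := hH.1 _ hf h0
      obtain ⟨g, hg, -⟩ := hH.2 _ hh
      rw [← hg] at e hh
      have e : ((f * g : ℝ → ℝ) : Filter.Germ (atTop : Filter ℝ) ℝ) =
        ((fun _ : ℝ => (1:ℝ) : ℝ → ℝ) : Filter.Germ (atTop : Filter ℝ) ℝ) := e
      have e : f * g =ᶠ[atTop] fun _ => (1:ℝ) := Filter.Germ.coe_eq.1 e
      refine Or.inr ⟨?_, ?_⟩
      · filter_upwards [e] with x hx h
        simp [h] at hx
      · rw [hcongr (f := g)]; · exact hh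
        filter_upwards [e] with x hx
        simp only [Pi.mul_apply] at hx
        simp only [Pi.inv_apply]
        exact inv_eq_of_mul_eq_one_right hx
  refine ⟨?_, ?_, ?_, ?_, ?_, ?_, fun f hf => (hdiff f hf).1, fun f hf => (hdiff f hf).2, ?_⟩
  · intro f hf g e
    show germAtTop g ∈ H
    rw [hcongr e]; exact hf
  · exact H.one_mem
  · intro f hf g hg; exact H.add_mem hf hg
  · intro f hf; exact H.neg_mem hf
  · intro f hf g hg; exact H.mul_mem hf hg
  · intro f hf
    rcases hinv f hf with h | h
    · have : germAtTop f⁻¹ = germAtTop 0 := hcongr (by filter_upwards [h] with x hx; simp [hx])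
      show germAtTop f⁻¹ ∈ H
      rw [this]; exact H.zero_mem
    · exact h.2
  · intro f hf
    rcases hinv f hf with h | h
    · exact Or.inl h
    · obtain ⟨a, ha⟩ := eventually_atTop.1 (h.1.and (hdiff f hf).1)
      have hc : ContinuousOn f (Set.Ici a) :=
        fun x hx => (ha x hx).2.continuousAt.continuousWithinAt
      have hpc : IsPreconnected (f '' Set.Ici a) := isPreconnected_Ici.image f hc
      have hnz : (0:ℝ) ∉ f '' Set.Ici a := by
        rintro ⟨x, hx, h0⟩
        exact (ha x hx).1 h0
      have hfa : f a ∈ f '' Set.Ici a := ⟨a, Set.self_mem_Ici, rfl⟩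
      rcases lt_or_gt_of_ne (ha a le_rfl).1 with hs | hs
      · refine Or.inr (Or.inr (eventually_atTop.2 ⟨a, fun x hx => ?_⟩))
        by_contra hx'
        exact hnz (hpc.ordConnected.out hfa ⟨x, hx, rfl⟩ ⟨hs.le, not_lt.1 hx'⟩)
      · refine Or.inr (Or.inl (eventually_atTop.2 ⟨a, fun x hx => ?_⟩))
        by_contra hx'
        exact hnz (hpc.ordConnected.out ⟨x, hx, rfl⟩ hfa ⟨not_lt.1 hx', hs.le⟩)

lemma exists_hs (H : Subring (Filter.Germ (Filter.atTop : Filter ℝ) ℝ)) (hH : IsHardyField H)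
    (f : ℝ → ℝ) (hf : germAtTop f ∈ H) :
    ∃ K, HS K ∧ f ∈ K ∧ (fun x : ℝ => x) ∈ K ∧ Real.log ∈ K := by
  have h0 := base_hs H hH
  have h1 : HS (FracS {g | germAtTop g ∈ H} (fun x : ℝ => x)) := by
    refine frac_hs h0 (by simp) ?_
    have : deriv (fun x : ℝ => x) = 1 := by ext x; simp
    rw [this]; exact h0.one
  have hx := frac_F h0 (F := fun x : ℝ => x)
  refine ⟨FracS _ Real.log, frac_hs h1 ?_ ?_, frac_of h1 (n := 0) (frac_of h0 (n := 0) hf),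
    frac_of h1 (n := 0) hx, frac_F h1⟩
  · filter_upwards [eventually_gt_atTop 0] with x hx
    exact Real.differentiableAt_log hx.ne'
  · refine h1.congr _ (h1.inv _ hx) _ (Eventually.of_forall fun x => ?_)
    simp

lemma no_top {g : ℝ → ℝ} (hd : ∀ᶠ x in atTop, DifferentiableAt ℝ g x)
    (h : ∀ᶠ x in atTop, deriv g x ≤ 0) (ht : Tendsto g atTop atTop) : False := by
  obtain ⟨a, ha⟩ := ex_mono (g := -g) (hd.mono fun x hx => hx.neg)
    (h.mono fun x hx => by rw [deriv.neg]; linarith)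
  obtain ⟨x, hx, hxa⟩ := ((ht.eventually_gt_atTop (g a)).and (eventually_ge_atTop a)).exists
  have := ha Set.self_mem_Ici hxa hxa
  simp only [Pi.neg_apply] at this
  linarith

lemma no_zero {g : ℝ → ℝ} (hd : ∀ᶠ x in atTop, DifferentiableAt ℝ g x)
    (h : ∀ᶠ x in atTop, 0 ≤ deriv g x) (hp : ∀ᶠ x in atTop, 0 < g x)
    (ht : Tendsto g atTop (𝓝 0)) : False := by
  obtain ⟨a, ha⟩ := ex_mono hd h
  obtain ⟨b, hb, hba⟩ := (hp.and (eventually_ge_atTop a)).exists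
  obtain ⟨x, hx, hxa⟩ := ((ht.eventually_lt_const hb).and (eventually_ge_atTop b)).exists
  have := ha hba (hba.trans hxa : a ≤ x) hxa
  linarith


section main
variable {K : Set (ℝ → ℝ)} (hK : HS K) (hX : (fun x : ℝ => x) ∈ K) (hL : Real.log ∈ K)
  {φ : ℝ → ℝ} (hφ : φ ∈ K)

lemma ev_pos {φ : ℝ → ℝ} {j : ℕ} (ht : Tendsto (fun x => x ^ j * φ x) atTop atTop) :
    ∀ᶠ x in atTop, 0 < φ x := by
  filter_upwards [ht.eventually_gt_atTop 0, eventually_gt_atTop 0] with x h1 h2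
  exact (mul_pos_iff_of_pos_left (pow_pos h2 j)).1 h1

include hK hφ

lemma deriv_neg_of {j : ℕ} (h0 : Tendsto φ atTop (𝓝 0))
    (ht : Tendsto (fun x => x ^ j * φ x) atTop atTop) : ∀ᶠ x in atTop, deriv φ x < 0 := by
  rcases hK.le_or_lt hK.zero (hK.deriv _ hφ) with h | h
  · exact (no_zero (hK.diff _ hφ) h (ev_pos ht) h0).elim
  · exact h

include hX

lemma lower_L {j : ℕ} (hj : 1 ≤ j)
    (ht : Tendsto (fun x => x ^ j * φ x) atTop atTop) :
    ∀ᶠ x in atTop, 0 ≤ x * deriv φ x + j * φ x := by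
  have hm : (fun x : ℝ => x) * deriv φ + (fun _ => (j:ℝ)) * φ ∈ K :=
    hK.add _ (hK.mul _ hX _ (hK.deriv _ hφ)) _ (hK.mul _ (hK.nat j) _ hφ)
  rcases hK.le_or_lt hK.zero hm with h | h
  · exact h
  exfalso
  obtain ⟨i, rfl⟩ := Nat.exists_eq_add_of_le' hj
  have hD : ∀ᶠ x in atTop, HasDerivAt (fun x => x ^ (i+1) * φ x)
      (x ^ i * (x * deriv φ x + (i+1 : ℕ) * φ x)) x := by
    filter_upwards [hK.diff _ hφ] with x hx
    refine ((hasDerivAt_pow (i+1) x).mul hx.hasDerivAt).congr_deriv ?_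
    simp only [Nat.add_sub_cancel]; ring
  refine no_top (hD.mono fun x hx => hx.differentiableAt) ?_ ht
  filter_upwards [hD, h, eventually_gt_atTop 0] with x h1 h2 h3
  rw [h1.deriv]
  simp only [Pi.add_apply, Pi.mul_apply, Pi.zero_apply] at h2
  exact mul_nonpos_of_nonneg_of_nonpos (by positivity) h2.le

lemma step_zero {j : ℕ} (hj : 1 ≤ j) (h0 : Tendsto φ atTop (𝓝 0))
    (ht : Tendsto (fun x => x ^ j * φ x) atTop atTop) : Tendsto (-deriv φ) atTop (𝓝 0) := by
  have hb : Tendsto (fun x => (j:ℝ) * φ x) atTop (𝓝 0) := by simpa using h0.const_mul (j:ℝ)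
  refine tendsto_of_tendsto_of_tendsto_of_le_of_le' tendsto_const_nhds hb ?_ ?_
  · filter_upwards [deriv_neg_of hK hφ h0 ht] with x hx
    simpa using hx.le
  · filter_upwards [deriv_neg_of hK hφ h0 ht, lower_L hK hX hφ hj ht, eventually_ge_atTop 1]
      with x h1 h2 h3
    simp only [Pi.neg_apply]
    nlinarith

lemma step_top {j : ℕ} (hj : 1 ≤ j) (h0 : Tendsto φ atTop (𝓝 0))
    (ht : Tendsto (fun x => x ^ j * φ x) atTop atTop) :
    Tendsto (fun x => x ^ (j+1) * (-deriv φ) x) atTop atTop := by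
  rw [tendsto_atTop]
  intro M
  obtain ⟨N, hN⟩ := exists_nat_ge M
  have hm : (fun x : ℝ => x) ^ (j+1) * (-deriv φ) ∈ K :=
    hK.mul _ (hK.pow hX _) _ (hK.neg _ (hK.deriv _ hφ))
  rcases hK.le_or_lt (hK.nat (N * j)) hm with h | h
  · filter_upwards [h] with x hx
    simp only [Pi.mul_apply, Pi.pow_apply] at hx
    have : (1:ℝ) ≤ j := by exact_mod_cast hj
    have hN0 : (0:ℝ) ≤ N := by positivity
    push_cast at hx
    nlinarith
  exfalso
  have hz : Tendsto (fun x : ℝ => φ x - N * (x ^ j)⁻¹) atTop (𝓝 0) := by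
    have := (tendsto_pow_atTop (α := ℝ) (by omega : j ≠ 0)).inv_tendsto_atTop
    simpa using h0.sub (this.const_mul (N:ℝ))
  obtain ⟨i, rfl⟩ := Nat.exists_eq_add_of_le' hj
  have hD : ∀ᶠ x in atTop, HasDerivAt (fun x : ℝ => φ x - N * (x ^ (i+1))⁻¹)
      (deriv φ x + N * (i+1 : ℕ) / x ^ (i+2)) x := by
    filter_upwards [hK.diff _ hφ, eventually_gt_atTop 0] with x hx h0
    refine (hx.hasDerivAt.sub (((hasDerivAt_pow (i+1) x).fun_inv (by positivity)).const_mul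
      (N:ℝ))).congr_deriv ?_
    simp only [Nat.add_sub_cancel]
    field_simp
    ring
  refine no_zero (hD.mono fun x hx => hx.differentiableAt) ?_ ?_ hz
  · filter_upwards [hD, h, eventually_gt_atTop 0] with x h1 h2 h3
    rw [h1.deriv]
    simp only [Pi.mul_apply, Pi.pow_apply, Pi.neg_apply] at h2
    have : -deriv φ x ≤ N * (i+1 : ℕ) / x ^ (i+2) := by
      rw [le_div_iff₀ (by positivity)]
      push_cast at h2 ⊢
      linarith
    linarith
  · filter_upwards [ht.eventually_gt_atTop (N:ℝ), eventually_gt_atTop 0] with x h1 h2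
    have : N * (x ^ (i+1))⁻¹ < φ x := by
      rw [← div_eq_mul_inv, div_lt_iff₀ (by positivity)]
      linarith
    linarith

include hL

lemma ii_lower {j : ℕ} (hj : 1 ≤ j)
    (ht : Tendsto (fun x => x ^ j * φ x) atTop atTop) :
    ∀ᶠ x in atTop, (1/2) / (Real.log x) ^ 2 ≤ x * deriv φ x / φ x + j := by
  have hm : (fun x : ℝ => x) * deriv φ / φ + (fun _ => (j:ℝ)) ∈ K :=
    hK.add _ (hK.div (hK.mul _ hX _ (hK.deriv _ hφ)) hφ) _ (hK.nat j)
  have hl : (1 / fun _ => ((2:ℕ):ℝ)) / Real.log ^ 2 ∈ K :=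
    hK.div (hK.div hK.one (hK.nat 2)) (hK.pow hL 2)
  rcases hK.le_or_lt hl hm with h | h
  · filter_upwards [h] with x hx
    simpa using hx
  exfalso
  obtain ⟨i, rfl⟩ := Nat.exists_eq_add_of_le' hj
  have hl1 := Real.tendsto_log_atTop.eventually_ge_atTop 1
  have hD : ∀ᶠ x in atTop, HasDerivAt (fun x => x ^ (i+1) * φ x * (1 + (Real.log x)⁻¹))
      (x ^ i * ((x * deriv φ x + (i+1 : ℕ) * φ x) * (1 + (Real.log x)⁻¹)
        - φ x / (Real.log x)^2)) x := by
    filter_upwards [hK.diff _ hφ, hl1, eventually_gt_atTop 0] with x hx h1 h0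
    refine (((hasDerivAt_pow (i+1) x).mul hx.hasDerivAt).mul
      (((Real.hasDerivAt_log h0.ne').fun_inv (by positivity)).const_add 1)).congr_deriv ?_
    simp only [Nat.add_sub_cancel, Pi.mul_apply]
    field_simp
    ring
  refine no_top (hD.mono fun x hx => hx.differentiableAt) ?_
    (tendsto_atTop_mono' atTop ?_ ht)
  · filter_upwards [hD, h, eventually_gt_atTop 0, hl1, ev_pos ht] with x h1 h2 h3 h4 h5
    rw [h1.deriv]
    apply mul_nonpos_of_nonneg_of_nonpos (by positivity)
    simp only [Pi.add_apply, Pi.mul_apply, Pi.div_apply, Pi.one_apply, Pi.pow_apply] at h2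
    have e : x * deriv φ x + (i+1 : ℕ) * φ x = (x * deriv φ x / φ x + (i+1:ℕ)) * φ x := by
      field_simp
    rw [e]
    have hi : (Real.log x)⁻¹ ≤ 1 := inv_le_one_of_one_le₀ h4
    have hi0 : 0 < (Real.log x)⁻¹ := by positivity
    have h6 : (x * deriv φ x / φ x + (i+1:ℕ)) * φ x ≤ 1 / (2:ℕ) / Real.log x ^ 2 * φ x :=
      mul_le_mul_of_nonneg_right h2.le h5.le
    have h7 := mul_le_mul_of_nonneg_right h6 (by positivity : 0 ≤ 1 + (Real.log x)⁻¹)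
    have h8 : 1 / ((2:ℕ):ℝ) / Real.log x ^ 2 * φ x * (1 + (Real.log x)⁻¹)
        ≤ 1 / ((2:ℕ):ℝ) / Real.log x ^ 2 * φ x * 2 :=
      mul_le_mul_of_nonneg_left (by linarith) (by positivity)
    have h9 : 1 / ((2:ℕ):ℝ) / Real.log x ^ 2 * φ x * 2 = φ x / Real.log x ^ 2 := by
      push_cast; ring
    linarith
  · filter_upwards [eventually_gt_atTop 0, hl1, ev_pos ht] with x h3 h4 h5
    exact le_mul_of_one_le_right (by positivity) (by linarith [show 0 < (Real.log x)⁻¹ by positivity])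

lemma iii_lower (h0 : Tendsto φ atTop (𝓝 0)) (hp : ∀ᶠ x in atTop, 0 < φ x) :
    ∀ᶠ x in atTop, 1 / (Real.log x) ^ 2 ≤ -(x * deriv φ x / φ x) := by
  have hm : -((fun x : ℝ => x) * deriv φ / φ) ∈ K :=
    hK.neg _ (hK.div (hK.mul _ hX _ (hK.deriv _ hφ)) hφ)
  have hl : 1 / Real.log ^ 2 ∈ K := hK.div hK.one (hK.pow hL 2)
  rcases hK.le_or_lt hl hm with h | h
  · filter_upwards [h] with x hx
    simpa using hx
  exfalso
  have hl1 := Real.tendsto_log_atTop.eventually_gt_atTop 1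
  have hD : ∀ᶠ x in atTop, HasDerivAt (fun x => φ x * (1 - (Real.log x)⁻¹))
      ((x * deriv φ x * (1 - (Real.log x)⁻¹) + φ x / (Real.log x)^2) / x) x := by
    filter_upwards [hK.diff _ hφ, hl1, eventually_gt_atTop 0] with x hx h1 h0
    refine (hx.hasDerivAt.mul
      (((Real.hasDerivAt_log h0.ne').fun_inv (by positivity)).const_sub 1)).congr_deriv ?_
    field_simp
  have hz : Tendsto (fun x : ℝ => φ x * (1 - (Real.log x)⁻¹)) atTop (𝓝 0) := by
    have := h0.mul (Real.tendsto_log_atTop.inv_tendsto_atTop.const_sub 1)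
    simpa using this
  refine no_zero (hD.mono fun x hx => hx.differentiableAt) ?_ ?_ hz
  · filter_upwards [hD, h, eventually_gt_atTop 0, hl1, hp] with x h1 h2 h3 h4 h5
    rw [h1.deriv]
    refine div_nonneg ?_ h3.le
    simp only [Pi.neg_apply, Pi.mul_apply, Pi.div_apply, Pi.one_apply, Pi.pow_apply] at h2
    have e : x * deriv φ x = (x * deriv φ x / φ x) * φ x := by field_simp
    have hi : (Real.log x)⁻¹ < 1 := inv_lt_one_of_one_lt₀ h4
    have hi0 : 0 < (Real.log x)⁻¹ := by positivity
    have h6 : -(1 / Real.log x ^ 2) * φ x ≤ x * deriv φ x := by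
      rw [e]; exact mul_le_mul_of_nonneg_right (by linarith) h5.le
    have h7 := mul_le_mul_of_nonneg_right h6 (by linarith : 0 ≤ 1 - (Real.log x)⁻¹)
    have h8 : 0 ≤ φ x / Real.log x ^ 2 * (Real.log x)⁻¹ := by positivity
    have h9 : -(1 / Real.log x ^ 2) * φ x * (1 - (Real.log x)⁻¹) =
      - (φ x / Real.log x ^ 2) + φ x / Real.log x ^ 2 * (Real.log x)⁻¹ := by ring
    linarith
  · filter_upwards [hl1, hp] with x h4 h5
    exact mul_pos h5 (by linarith [inv_lt_one_of_one_lt₀ h4])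

lemma i_bounds (hp : ∀ᶠ x in atTop, 0 < φ x) (hx0 : Tendsto (fun x => φ x / x) atTop (𝓝 0))
    (hlog : Tendsto (fun x => φ x / Real.log x) atTop atTop) :
    ∀ᶠ x in atTop, 1 / Real.log x ≤ x * deriv φ x / φ x ∧ x * deriv φ x / φ x ≤ 1 := by
  have hm : ((fun x : ℝ => x) * deriv φ / φ) ∈ K :=
    (hK.div (hK.mul _ hX _ (hK.deriv _ hφ)) hφ)
  have hl1 := Real.tendsto_log_atTop.eventually_gt_atTop 1
  refine Eventually.and ?_ ?_
  · rcases hK.le_or_lt (hK.div hK.one hL) hm with h | h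
    · filter_upwards [h] with x hx
      simpa using hx
    exfalso
    have hD : ∀ᶠ x in atTop, HasDerivAt (fun x => φ x / Real.log x)
        ((x * deriv φ x / φ x - 1 / Real.log x) * (φ x / (x * Real.log x))) x := by
      filter_upwards [hK.diff _ hφ, hl1, eventually_gt_atTop 0, hp] with x hx h1 h0 hp
      refine (hx.hasDerivAt.fun_div (Real.hasDerivAt_log h0.ne') (by positivity)).congr_deriv ?_
      field_simp
    refine no_top (hD.mono fun x hx => hx.differentiableAt) ?_ hlog
    filter_upwards [hD, h, eventually_gt_atTop 0, hl1, hp] with x h1 h2 h3 h4 h5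
    rw [h1.deriv]
    simp only [Pi.mul_apply, Pi.div_apply, Pi.one_apply] at h2
    exact mul_nonpos_of_nonpos_of_nonneg (by linarith) (by positivity)
  · rcases hK.le_or_lt hm hK.one with h | h
    · filter_upwards [h] with x hx
      simpa using hx
    exfalso
    have hD : ∀ᶠ x in atTop, HasDerivAt (fun x => φ x / x)
        ((x * deriv φ x / φ x - 1) * (φ x / (x * x))) x := by
      filter_upwards [hK.diff _ hφ, eventually_gt_atTop 0, hp] with x hx h0 hp
      refine (hx.hasDerivAt.fun_div (hasDerivAt_id' x) (by positivity)).congr_deriv ?_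
      field_simp
    refine no_zero (hD.mono fun x hx => hx.differentiableAt) ?_ ?_ hx0
    · filter_upwards [hD, h, eventually_gt_atTop 0, hp] with x h1 h2 h3 h5
      rw [h1.deriv]
      simp only [Pi.mul_apply, Pi.div_apply, Pi.one_apply] at h2
      exact mul_nonneg (by linarith) (by positivity)
    · filter_upwards [eventually_gt_atTop 0, hp] with x h1 h2 using div_pos h2 h1

end main

lemma neg_ratio (g : ℝ → ℝ) (x : ℝ) : x * deriv (-g) x / (-g) x = x * deriv g x / g x := by
  rw [deriv.neg]; simp only [Pi.neg_apply]
  rw [mul_neg, neg_div_neg_eq]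

lemma main_pos {K : Set (ℝ → ℝ)} (hK : HS K) (hX : (fun x : ℝ => x) ∈ K) (hL : Real.log ∈ K)
    {f : ℝ → ℝ} (hf : f ∈ K) (hp : ∀ᶠ x in atTop, 0 < f x)
    (hx0 : Tendsto (fun x => f x / x) atTop (𝓝 0))
    (hlog : Tendsto (fun x => f x / Real.log x) atTop atTop)
    (hder : Filter.Tendsto (fun x : ℝ => x * |deriv f x|) Filter.atTop Filter.atTop) :
    (∀ᶠ x in atTop, 1 / Real.log x ≤ x * deriv f x / f x ∧ x * deriv f x / f x ≤ 1) ∧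
    (∀ j : ℕ, 1 ≤ j → ∃ φ, (φ = iteratedDeriv j f ∨ φ = -iteratedDeriv j f) ∧ φ ∈ K ∧
      Tendsto φ atTop (𝓝 0) ∧ Tendsto (fun x => x ^ j * φ x) atTop atTop) := by
  have hi := i_bounds hK hX hL hf hp hx0 hlog
  have hl1 := Real.tendsto_log_atTop.eventually_gt_atTop 1
  refine ⟨hi, ?_⟩
  have hb : ∀ᶠ x in atTop, 0 < deriv f x ∧ deriv f x ≤ f x / x := by
    filter_upwards [hi, hp, hl1, eventually_gt_atTop 0] with x h1 h2 h3 h4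
    constructor
    · have : 0 < x * deriv f x / f x := lt_of_lt_of_le (by positivity) h1.1
      rw [div_pos_iff_of_pos_right h2] at this
      exact (mul_pos_iff_of_pos_left h4).1 this
    · rw [le_div_iff₀ h4]
      have := (div_le_iff₀ h2).1 h1.2
      linarith
  intro j hj
  induction j, hj using Nat.le_induction with
  | base =>
    refine ⟨deriv f, Or.inl iteratedDeriv_one.symm, hK.deriv _ hf, ?_, ?_⟩
    · exact tendsto_of_tendsto_of_tendsto_of_le_of_le' tendsto_const_nhds hx0
        (hb.mono fun x hx => hx.1.le) (hb.mono fun x hx => hx.2)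
    · refine hder.congr' ?_
      filter_upwards [hb] with x hx
      rw [abs_of_pos hx.1, pow_one]
  | succ j hj ih =>
    obtain ⟨φ, he, hφ, h0, ht⟩ := ih
    refine ⟨-deriv φ, ?_, hK.neg _ (hK.deriv _ hφ), step_zero hK hX hφ hj h0 ht,
      step_top hK hX hφ hj h0 ht⟩
    rw [iteratedDeriv_succ]
    rcases he with rfl | rfl
    · exact Or.inr rfl
    · left; ext x; simp

lemma main_all {K : Set (ℝ → ℝ)} (hK : HS K) (hX : (fun x : ℝ => x) ∈ K) (hL : Real.log ∈ K)
    {f : ℝ → ℝ} (hf : f ∈ K)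
    (hx0 : Tendsto (fun x => f x / x) atTop (𝓝 0))
    (hlog : Tendsto (fun x => |f x / Real.log x|) atTop atTop)
    (hder : Filter.Tendsto (fun x : ℝ => x * |deriv f x|) Filter.atTop Filter.atTop) :
    (∀ᶠ x in atTop, 1 / Real.log x ≤ x * deriv f x / f x ∧ x * deriv f x / f x ≤ 1) ∧
    (∀ j : ℕ, 1 ≤ j → ∃ φ, (φ = iteratedDeriv j f ∨ φ = -iteratedDeriv j f) ∧ φ ∈ K ∧
      Tendsto φ atTop (𝓝 0) ∧ Tendsto (fun x => x ^ j * φ x) atTop atTop) := by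
  have hl1 := Real.tendsto_log_atTop.eventually_gt_atTop 1
  rcases hK.tri f hf with h | h | h
  · exfalso
    obtain ⟨x, h1, h2⟩ := (h.and (hlog.eventually_gt_atTop 0)).exists
    simp [h1] at h2
  · refine main_pos hK hX hL hf h hx0 (hlog.congr' ?_) hder
    filter_upwards [h, hl1] with x h1 h2
    exact abs_of_pos (div_pos h1 (by linarith))
  · have := main_pos hK hX hL (hK.neg _ hf) (h.mono fun x hx => by simpa using hx)
      (by simpa [neg_div] using hx0.neg) (hlog.congr' ?_) (by simpa [deriv.neg] using hder)
    · refine ⟨?_, ?_⟩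
      · filter_upwards [this.1] with x hx
        rwa [neg_ratio] at hx
      · intro j hj
        obtain ⟨φ, he, h'⟩ := this.2 j hj
        refine ⟨φ, ?_, h'⟩
        have e : iteratedDeriv j (-f) = -iteratedDeriv j f := by ext x; simp [iteratedDeriv_neg]
        rw [e, neg_neg] at he
        exact he.symm
    · filter_upwards [h, hl1] with x h1 h2
      simp only [Pi.neg_apply]
      rw [abs_of_neg (div_neg_of_neg_of_pos h1 (by linarith)), neg_div]

end HardyAux

/-- Differential inequalities for a subpolynomial `f` in a Hardy field of type
`x^{0+}` with `|f(x)/log x| → ∞` and `x·|f'(x)| → ∞`. -/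
theorem hardy_type_zero_differential_inequalities
    (H : Subring (Filter.Germ (Filter.atTop : Filter ℝ) ℝ)) (hH : IsHardyField H)
    (f : ℝ → ℝ) (hfH : germAtTop f ∈ H) (hsub : Subpolynomial f)
    (htype : TypeXPow f 0)
    (hlog : Filter.Tendsto (fun x : ℝ => |f x / Real.log x|) Filter.atTop Filter.atTop)
    (hder : Filter.Tendsto (fun x : ℝ => x * |deriv f x|) Filter.atTop Filter.atTop) :
    (∃ c C : ℝ, 0 < c ∧ ∀ᶠ x in Filter.atTop,
      c / Real.log x ≤ x * deriv f x / f x ∧ x * deriv f x / f x ≤ C) ∧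
    (∀ j : ℕ, 1 ≤ j → ∃ c C : ℝ, 0 < c ∧ ∀ᶠ x in Filter.atTop,
      c / (Real.log x) ^ 2 ≤ |x * iteratedDeriv (j + 1) f x / iteratedDeriv j f x + j| ∧
      |x * iteratedDeriv (j + 1) f x / iteratedDeriv j f x + j| ≤ C) ∧
    (∀ j : ℕ, 1 ≤ j → ∃ c C : ℝ, 0 < c ∧ ∀ᶠ x in Filter.atTop,
      c / (Real.log x) ^ 2 ≤ |x * iteratedDeriv (j + 1) f x / iteratedDeriv j f x| ∧
      |x * iteratedDeriv (j + 1) f x / iteratedDeriv j f x| ≤ C) ∧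
    (∃ C : ℝ, ∀ᶠ x in Filter.atTop,
      0 < deriv f x / deriv f (2 * x) ∧ deriv f x / deriv f (2 * x) ≤ C * Real.log x) := by
  obtain ⟨K, hK, hf, hX, hL⟩ := HardyAux.exists_hs H hH f hfH
  have hx0 : Tendsto (fun x => f x / x) atTop (𝓝 0) := by simpa using htype.2
  obtain ⟨h1, h2⟩ := HardyAux.main_all hK hX hL hf hx0 hlog hder
  have h3 : ∀ j : ℕ, 1 ≤ j → ∀ᶠ x in atTop,
      (1/2) / (Real.log x) ^ 2 ≤ x * iteratedDeriv (j + 1) f x / iteratedDeriv j f x + j ∧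
      1 / (Real.log x) ^ 2 ≤ -(x * iteratedDeriv (j + 1) f x / iteratedDeriv j f x) := by
    intro j hj
    obtain ⟨φ, he, hφ, h0, ht⟩ := h2 j hj
    have hr : ∀ x, x * iteratedDeriv (j + 1) f x / iteratedDeriv j f x
        = x * deriv φ x / φ x := by
      intro x
      rw [iteratedDeriv_succ]
      rcases he with rfl | rfl
      · rfl
      · rw [HardyAux.neg_ratio]
    simp only [hr]
    exact (HardyAux.ii_lower hK hX hL hφ hj ht).and
      (HardyAux.iii_lower hK hX hL hφ h0 (HardyAux.ev_pos ht))
  have hl1 := Real.tendsto_log_atTop.eventually_gt_atTop 1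
  refine ⟨⟨1, 1, one_pos, h1⟩, fun j hj => ⟨1/2, j, by norm_num, ?_⟩,
    fun j hj => ⟨1, j, one_pos, ?_⟩, 2, ?_⟩
  · filter_upwards [h3 j hj, hl1] with x h h'
    have p1 : 0 < (1/2) / (Real.log x) ^ 2 := by positivity
    have p2 : 0 < 1 / (Real.log x) ^ 2 := by positivity
    rw [abs_of_pos (by linarith [h.1])]
    exact ⟨h.1, by linarith [h.2]⟩
  · filter_upwards [h3 j hj, hl1] with x h h'
    have p1 : 0 < (1/2) / (Real.log x) ^ 2 := by positivity
    have p2 : 0 < 1 / (Real.log x) ^ 2 := by positivity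
    rw [abs_of_neg (by linarith [h.2])]
    exact ⟨h.2, by linarith [h.1]⟩
  · obtain ⟨φ, he, hφ, h0, ht⟩ := h2 1 le_rfl
    rw [iteratedDeriv_one] at he
    have hr : ∀ x, deriv f x / deriv f (2 * x) = φ x / φ (2 * x) := by
      intro x
      rcases he with rfl | rfl
      · rfl
      · simp only [Pi.neg_apply, neg_div_neg_eq]
    simp only [hr]
    have hD : ∀ᶠ x in atTop, HasDerivAt (fun x => x * φ x) (x * deriv φ x + (1:ℕ) * φ x) x := by
      filter_upwards [hK.diff _ hφ] with x hx
      refine ((hasDerivAt_id' x).mul hx.hasDerivAt).congr_deriv ?_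
      push_cast; ring
    obtain ⟨a, ha⟩ := HardyAux.ex_mono (hD.mono fun x hx => hx.differentiableAt) (by
      filter_upwards [hD, HardyAux.lower_L hK hX hφ le_rfl ht] with x h h'
      rw [h.deriv]; exact h')
    obtain ⟨b, hb⟩ := eventually_atTop.1 (HardyAux.ev_pos ht)
    filter_upwards [hl1, eventually_ge_atTop a, eventually_ge_atTop b, eventually_gt_atTop 0]
      with x h1 h2 h3 h4
    have p1 := hb x h3
    have p2 := hb (2 * x) (by linarith)
    refine ⟨div_pos p1 p2, ?_⟩
    have hle : x ≤ 2 * x := by linarith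
    have hm := ha (show x ∈ Set.Ici a from h2) (show 2 * x ∈ Set.Ici a from h2.trans hle) hle
    have hm : x * φ x ≤ 2 * x * φ (2 * x) := hm
    have : φ x / φ (2 * x) ≤ 2 := by
      rw [div_le_iff₀ p2]
      nlinarith
    linarith

end
end

section
/- Let D ⊆ ℤ^d be a nice FC⁺ set and let L : ℤ^d → ℤ^e be a linear map such that (0, …, 0) ∉ L(D). Then L(D) is a nice FC⁺ set in ℤ^e. -/
open Filter Topology MeasureTheory
open scoped Pointwise

noncomputable section

/-- The character of the torus attached to `v`. -/
def torChar {m : ℕ} (v : Fin m → ℤ) (γ : Fin m → AddCircle (1 : ℝ)) : ℂ :=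
  ∏ i, fourier (v i) (γ i)

lemma torChar_eq {m : ℕ} (v : Fin m → ℤ) (γ : Fin m → AddCircle (1 : ℝ)) :
    torChar v γ = (AddCircle.toCircle (∑ i, v i • γ i) : ℂ) := by
  classical
  unfold torChar
  have key : ∀ s : Finset (Fin m), ∏ i ∈ s, (fourier (v i) (γ i) : ℂ)
      = (AddCircle.toCircle (∑ i ∈ s, v i • γ i) : ℂ) := by
    intro s
    induction s using Finset.induction_on with
    | empty => simp
    | insert a s ha ih =>
      rw [Finset.prod_insert ha, Finset.sum_insert ha, AddCircle.toCircle_add, ih, fourier_apply]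
      simp
  exact key _

lemma torChar_norm {m : ℕ} (v : Fin m → ℤ) (γ : Fin m → AddCircle (1 : ℝ)) :
    ‖torChar v γ‖ = 1 := by
  rw [torChar_eq]; exact Circle.norm_coe _

lemma torChar_add {m : ℕ} (v : Fin m → ℤ) (γ δ : Fin m → AddCircle (1 : ℝ)) :
    torChar v (γ + δ) = torChar v γ * torChar v δ := by
  simp only [torChar_eq, Pi.add_apply, smul_add, Finset.sum_add_distrib, AddCircle.toCircle_add]
  simp

lemma torChar_continuous {m : ℕ} (v : Fin m → ℤ) :
    Continuous (torChar (m := m) v) := by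
  unfold torChar
  fun_prop

lemma torChar_integrable {m : ℕ} (σ : Measure (Fin m → AddCircle (1 : ℝ))) [IsFiniteMeasure σ]
    (v : Fin m → ℤ) : Integrable (torChar v) σ :=
  Integrable.of_bound (torChar_continuous v).aestronglyMeasurable 1
    (Eventually.of_forall fun γ => (torChar_norm v γ).le)

lemma measureFourier_eq {m : ℕ} (σ : Measure (Fin m → AddCircle (1 : ℝ))) (v : Fin m → ℤ) :
    measureFourier σ v = ∫ γ, torChar v γ ∂σ := rfl

lemma measureFourier_norm_le {m : ℕ} (σ : Measure (Fin m → AddCircle (1 : ℝ)))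
    [IsFiniteMeasure σ] (v : Fin m → ℤ) : ‖measureFourier σ v‖ ≤ σ.real Set.univ := by
  rw [measureFourier_eq]
  have := norm_integral_le_of_norm_le_const (μ := σ)
    (Eventually.of_forall fun γ => (torChar_norm v γ).le)
  simpa using this

/-- Convolution of finite measures: Fourier transforms multiply, masses at zero supermultiply. -/
lemma exists_conv {m : ℕ} (σ τ : Measure (Fin m → AddCircle (1 : ℝ)))
    [IsFiniteMeasure σ] [IsFiniteMeasure τ] :
    ∃ κ : Measure (Fin m → AddCircle (1 : ℝ)), IsFiniteMeasure κ ∧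
      (∀ v, measureFourier κ v = measureFourier σ v * measureFourier τ v) ∧
      σ.real {0} * τ.real {0} ≤ κ.real {0} := by
  have hm : Measurable (fun p : (Fin m → AddCircle (1 : ℝ)) × (Fin m → AddCircle (1 : ℝ)) =>
      p.1 + p.2) := by fun_prop
  refine ⟨(σ.prod τ).map (fun p => p.1 + p.2), inferInstance, ?_, ?_⟩
  · intro v
    rw [measureFourier_eq, integral_map hm.aemeasurable
      (torChar_continuous v).aestronglyMeasurable]
    simp only [torChar_add]
    exact integral_prod_mul (torChar v) (torChar v)
  · rw [map_measureReal_apply hm (measurableSet_singleton _), ← measureReal_prod_prod]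
    refine measureReal_mono ?_ (measure_ne_top _ _)
    rintro ⟨x, y⟩ ⟨hx, hy⟩
    simp only [Set.mem_singleton_iff] at hx hy
    simp [hx, hy]

lemma exists_pow {m : ℕ} (σ : Measure (Fin m → AddCircle (1 : ℝ))) [IsFiniteMeasure σ] (n : ℕ) :
    ∃ κ : Measure (Fin m → AddCircle (1 : ℝ)), IsFiniteMeasure κ ∧
      (∀ v, measureFourier κ v = measureFourier σ v ^ n) ∧
      σ.real {0} ^ n ≤ κ.real {0} := by
  induction n with
  | zero =>
    refine ⟨Measure.dirac 0, inferInstance, ?_, ?_⟩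
    · intro v
      rw [measureFourier_eq, integral_dirac, torChar_eq]
      simp
    · simp [measureReal_def]
  | succ n ih =>
    obtain ⟨κ, hκ, h1, h2⟩ := ih
    obtain ⟨κ', hκ', hfour, hmass⟩ := exists_conv κ σ
    refine ⟨κ', hκ', fun v => by rw [hfour, h1, pow_succ], ?_⟩
    rw [pow_succ]
    exact (mul_le_mul_of_nonneg_right h2 measureReal_nonneg).trans hmass

/-- A point where the character is `-1`. -/
lemma exists_neg_one {m : ℕ} (v : Fin m → ℤ) (hv : v ≠ 0) :
    ∃ x, torChar v x = -1 := by
  obtain ⟨i, hi⟩ := Function.ne_iff.mp hv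
  have hi' : (v i : ℝ) ≠ 0 := by exact_mod_cast hi
  refine ⟨Pi.single i (((1 / (2 * (v i : ℝ)) : ℝ)) : AddCircle (1 : ℝ)), ?_⟩
  rw [torChar_eq, Finset.sum_eq_single i]
  · rw [Pi.single_eq_same, ← AddCircle.coe_zsmul, AddCircle.toCircle_apply_mk, Circle.coe_exp]
    rw [← Complex.exp_pi_mul_I]
    congr 2
    rw [Complex.ofReal_inj, zsmul_eq_mul]
    field_simp
  · intro j _ hj
    simp [hj]
  · simp

lemma exists_kill {m : ℕ} (S : Finset (Fin m → ℤ)) (hS : (0 : Fin m → ℤ) ∉ S) :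
    ∃ κ : Measure (Fin m → AddCircle (1 : ℝ)), IsFiniteMeasure κ ∧
      (∀ v ∈ S, measureFourier κ v = 0) ∧ 1 ≤ κ.real {0} := by
  classical
  induction S using Finset.induction_on with
  | empty => exact ⟨Measure.dirac 0, inferInstance, by simp, by simp [measureReal_def]⟩
  | insert a S ha ih =>
    obtain ⟨κ, hκ, h1, h2⟩ := ih (fun h => hS (Finset.mem_insert_of_mem h))
    obtain ⟨x, hx⟩ := exists_neg_one a (fun h => hS (h ▸ Finset.mem_insert_self a S))
    obtain ⟨κ', hκ', hfour, hmass⟩ := exists_conv κ (Measure.dirac 0 + Measure.dirac x)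
    refine ⟨κ', hκ', ?_, ?_⟩
    · intro v hv
      rw [hfour]
      rcases Finset.mem_insert.mp hv with rfl | hv
      · have : measureFourier (Measure.dirac 0 + Measure.dirac x) v = 0 := by
          rw [measureFourier_eq, integral_add_measure (torChar_integrable _ _)
            (torChar_integrable _ _), integral_dirac, integral_dirac, hx, torChar_eq]
          simp
        rw [this, mul_zero]
      · rw [h1 v hv, zero_mul]
    · have : 1 ≤ (Measure.dirac 0 + Measure.dirac x :
          Measure (Fin m → AddCircle (1 : ℝ))).real {0} := by
        rw [measureReal_add_apply]
        have h : (Measure.dirac (0 : Fin m → AddCircle (1 : ℝ))).real {0} = 1 := by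
          simp [measureReal_def]
        rw [h]
        linarith [measureReal_nonneg (μ := Measure.dirac x)
          (s := ({0} : Set (Fin m → AddCircle (1 : ℝ))))]
      nlinarith

/-- Pushforward under the dual of `L`. -/
lemma exists_push {d e' : ℕ} (L : (Fin d → ℤ) →ₗ[ℤ] (Fin e' → ℤ))
    (σ : Measure (Fin e' → AddCircle (1 : ℝ))) [IsFiniteMeasure σ] :
    ∃ κ : Measure (Fin d → AddCircle (1 : ℝ)), IsFiniteMeasure κ ∧
      (∀ v, measureFourier κ v = measureFourier σ (L v)) ∧ σ.real {0} ≤ κ.real {0} := by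
  classical
  let T : (Fin e' → AddCircle (1 : ℝ)) → (Fin d → AddCircle (1 : ℝ)) :=
    fun γ i => ∑ j, L (Pi.single i 1) j • γ j
  have hT : Continuous T := by
    refine continuous_pi fun i => continuous_finsetSum _ fun j _ => ?_
    exact (continuous_apply j).zsmul _
  refine ⟨σ.map T, inferInstance, ?_, ?_⟩
  · intro v
    rw [measureFourier_eq, integral_map hT.measurable.aemeasurable
      (torChar_continuous v).aestronglyMeasurable, measureFourier_eq]
    congr 1
    ext γ
    rw [torChar_eq, torChar_eq]
    congr 2
    have hL : ∀ j, L v j = ∑ i, v i * L (Pi.single i 1) j := by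
      intro j
      conv_lhs => rw [← Finset.univ_sum_single v]
      rw [map_sum, Finset.sum_apply]
      refine Finset.sum_congr rfl fun i _ => ?_
      have : (Pi.single i (v i) : Fin d → ℤ) = v i • Pi.single i 1 := by
        rw [← Pi.single_smul]; simp
      rw [this, map_smul]; simp
    simp only [T, hL, Finset.smul_sum, Finset.sum_smul, mul_smul]
    exact Finset.sum_comm
  · rw [map_measureReal_apply hT.measurable (measurableSet_singleton _)]
    refine measureReal_mono ?_ (measure_ne_top _ _)
    rintro x hx
    simp only [Set.mem_singleton_iff] at hx
    subst hx
    ext i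
    simp [T]

lemma key_false {d e' : ℕ} (D : Set (Fin d → ℤ)) (hD : IsNiceFCPlus D)
    (L : (Fin d → ℤ) →ₗ[ℤ] (Fin e' → ℤ)) (h0 : (0 : Fin e' → ℤ) ∉ L '' D)
    (σ : Measure (Fin e' → AddCircle (1 : ℝ))) [IsFiniteMeasure σ]
    (S : Set (Fin e' → ℤ)) (hS : S.Finite) (c : ℝ) (hc0 : 0 ≤ c) (hc : c < σ.real {0})
    (h : ∀ v ∈ L '' D, v ∉ S → ‖measureFourier σ v‖ ≤ c) : False := by
  classical
  obtain ⟨ρ, hρ, hρ1, hρ2⟩ := exists_kill (hS.toFinset.erase 0) (by simp)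
  have ha : 0 < σ.real {0} := hc0.trans_lt hc
  obtain ⟨n, hn⟩ : ∃ n : ℕ, c ^ n * ρ.real Set.univ < σ.real {0} ^ n := by
    have ht : Tendsto (fun n : ℕ => (c / σ.real {0}) ^ n * ρ.real Set.univ) atTop (𝓝 0) := by
      have := (tendsto_pow_atTop_nhds_zero_of_lt_one (div_nonneg hc0 ha.le)
        ((div_lt_one ha).mpr hc)).mul_const (ρ.real Set.univ)
      simpa using this
    obtain ⟨n, hn⟩ := (ht.eventually_lt_const one_pos).exists
    refine ⟨n, ?_⟩
    rw [div_pow, div_mul_eq_mul_div, div_lt_one (pow_pos ha n)] at hn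
    exact hn
  obtain ⟨κ, hκ, hκ1, hκ2⟩ := exists_pow σ n
  obtain ⟨τ, hτ, hτ1, hτ2⟩ := exists_conv κ ρ
  obtain ⟨ω, hω, hω1, hω2⟩ := exists_push L τ
  have hlow : σ.real {0} ^ n ≤ ω.real {0} := by
    have : 0 ≤ κ.real {0} := measureReal_nonneg
    nlinarith
  have hB : 0 ≤ c ^ n * ρ.real Set.univ := mul_nonneg (pow_nonneg hc0 n) measureReal_nonneg
  have hup : ∀ v ∈ D, ‖measureFourier ω v‖ ≤ c ^ n * ρ.real Set.univ := by
    intro v hv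
    rw [hω1, hτ1, hκ1, norm_mul, norm_pow]
    by_cases hvS : L v ∈ S
    · have hne : L v ≠ 0 := fun h => h0 (h ▸ Set.mem_image_of_mem L hv)
      rw [hρ1 (L v) (by simp [hne, hvS])]
      simpa using hB
    · exact mul_le_mul (pow_le_pow_left₀ (norm_nonneg _)
        (h _ (Set.mem_image_of_mem L hv) hvS) n) (measureFourier_norm_le ρ _)
        (norm_nonneg _) (pow_nonneg hc0 n)
  have hlim : Filter.limsup (fun d => ‖measureFourier ω d‖) (alongD D)
      ≤ c ^ n * ρ.real Set.univ := by
    have hev : ∀ᶠ v in alongD D, ‖measureFourier ω v‖ ≤ c ^ n * ρ.real Set.univ := by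
      filter_upwards [(inf_le_right : alongD D ≤ 𝓟 D) (mem_principal_self D)] with v hv
      exact hup v hv
    rcases eq_or_neBot (alongD D) with hb | hb
    · rw [hb]
      simpa [Filter.limsup_eq] using hB
    · exact limsup_le_of_le (isCoboundedUnder_le_of_le _ (x := 0) fun _ => norm_nonneg _) hev
  have := hD.2 ω hω
  rw [← measureReal_def] at this
  linarith

/-- The image of a nice `FC⁺` set `D ⊆ ℤ^d` under a linear map
`L : ℤ^d → ℤ^e` with `0 ∉ L(D)` is a nice `FC⁺` set. -/
theorem image_nice_FC_plus
    {d e' : ℕ} (D : Set (Fin d → ℤ)) (hD : IsNiceFCPlus D)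
    (L : (Fin d → ℤ) →ₗ[ℤ] (Fin e' → ℤ)) (h0 : (0 : Fin e' → ℤ) ∉ L '' D) :
    IsNiceFCPlus (L '' D) := by
  classical
  refine ⟨fun hfin => ?_, fun σ hσ => ?_⟩
  · refine key_false D hD L h0 (Measure.dirac 0) _ hfin 0 le_rfl ?_ (fun v hv hv' => (hv' hv).elim)
    simp [measureReal_def]
  · by_contra! hlt
    rw [← measureReal_def] at hlt
    have hnn : 0 ≤ Filter.limsup (fun d => ‖measureFourier σ d‖) (alongD (L '' D)) := by
      rcases eq_or_neBot (alongD (L '' D)) with hb | hb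
      · rw [hb]
        simp [Filter.limsup_eq]
      · exact le_limsup_of_frequently_le (Frequently.of_forall fun _ => norm_nonneg _)
          (isBoundedUnder_of ⟨σ.real Set.univ, fun v => measureFourier_norm_le σ v⟩)
    obtain ⟨c, hc1, hc2⟩ := exists_between hlt
    have hev := eventually_lt_of_limsup_lt hc1
      (isBoundedUnder_of ⟨σ.real Set.univ, fun v => measureFourier_norm_le σ v⟩)
    rw [alongD, eventually_inf_principal, eventually_comap] at hev
    obtain ⟨R, hR⟩ := eventually_atTop.mp hev
    refine key_false D hD L h0 σ (Set.pi Set.univ fun _ => Set.Icc (-(R : ℤ)) R)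
      (Set.Finite.pi fun _ => Set.finite_Icc _ _) c
      (hnn.trans hc1.le) hc2 ?_
    intro v hv hvS
    refine (hR _ ?_ v rfl hv).le
    simp only [Set.mem_pi, Set.mem_univ, true_implies, not_forall] at hvS
    obtain ⟨i, hi⟩ := hvS
    have h1 := Finset.le_sup (f := fun i => (v i).natAbs) (Finset.mem_univ i)
    simp only [Set.mem_Icc] at hi
    omega

end
end
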